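/- Let W be a finite-dimensional smooth representation of B(ℤ_p) over F with dim_F W ≥ 2. Assume the space of U(ℤ_p)-coinvariants W_{U(ℤ_p)} (the quotient of W by the subspace spanned by all uw − w with u ∈ U(ℤ_p), w ∈ W) is one-dimensional and that T(ℤ_p) acts on it by the character χ. Then the space of U(ℤ_p)-coinvariants (Sym¹F² ⊗_F W)_{U(ℤ_p)} is two-dimensional and is isomorphic as a representation of T(ℤ_p) to the direct sum of the two characters χ·χ_{1,0} and χ·χ_{1,0}^s. -/

import Mathlib

open TensorProduct

section Setup

variable (p : ℕ) [Fact p.Prime]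

/-- `K = GL₂(ℤ_p)`. -/
abbrev GL2 := Matrix.GeneralLinearGroup (Fin 2) ℤ_[p]

/-- `B(ℤ_p)`: the subgroup of upper triangular matrices in `GL₂(ℤ_p)`. -/
def Bsub : Subgroup (GL2 p) where
  carrier := {g | (g : Matrix (Fin 2) (Fin 2) ℤ_[p]) 1 0 = 0}
  one_mem' := by
    show ((1 : GL2 p) : Matrix (Fin 2) (Fin 2) ℤ_[p]) 1 0 = 0
    rw [Units.val_one]
    simp [Matrix.one_apply]
  mul_mem' := by
    intro a b ha hb
    simp only [Set.mem_setOf_eq] at ha hb ⊢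
    show ((a * b : GL2 p) : Matrix (Fin 2) (Fin 2) ℤ_[p]) 1 0 = 0
    rw [Units.val_mul, Matrix.mul_apply, Fin.sum_univ_two]
    simp [ha, hb]
  inv_mem' := by
    intro g hg
    simp only [Set.mem_setOf_eq] at hg ⊢
    show ((g⁻¹ : GL2 p) : Matrix (Fin 2) (Fin 2) ℤ_[p]) 1 0 = 0
    rw [Matrix.coe_units_inv, Matrix.inv_def]
    simp [Matrix.adjugate_fin_two, hg]

/-- `U(ℤ_p)`: the upper triangular unipotent subgroup, as a subgroup of `B(ℤ_p)`. -/
def Usub : Subgroup ↥(Bsub p) where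
  carrier := {g | ((g : GL2 p) : Matrix (Fin 2) (Fin 2) ℤ_[p]) 0 0 = 1 ∧
                  ((g : GL2 p) : Matrix (Fin 2) (Fin 2) ℤ_[p]) 1 1 = 1}
  one_mem' := by
    constructor <;>
    · show ((1 : GL2 p) : Matrix (Fin 2) (Fin 2) ℤ_[p]) _ _ = 1
      rw [Units.val_one]
      simp [Matrix.one_apply]
  mul_mem' := by
    intro a b ha hb
    simp only [Set.mem_setOf_eq] at ha hb ⊢
    have hb10 : ((b : GL2 p) : Matrix (Fin 2) (Fin 2) ℤ_[p]) 1 0 = 0 := b.2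
    have ha10 : ((a : GL2 p) : Matrix (Fin 2) (Fin 2) ℤ_[p]) 1 0 = 0 := a.2
    constructor <;>
    · show (((a * b : ↥(Bsub p)) : GL2 p) : Matrix (Fin 2) (Fin 2) ℤ_[p]) _ _ = 1
      rw [show ((a * b : ↥(Bsub p)) : GL2 p) = (a : GL2 p) * (b : GL2 p) from rfl]
      rw [Units.val_mul, Matrix.mul_apply, Fin.sum_univ_two]
      simp [ha.1, ha.2, hb.1, hb.2, hb10, ha10]
  inv_mem' := by
    intro g hg
    simp only [Set.mem_setOf_eq] at hg ⊢
    have hg10 : ((g : GL2 p) : Matrix (Fin 2) (Fin 2) ℤ_[p]) 1 0 = 0 := g.2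
    have hco : ((g⁻¹ : ↥(Bsub p)) : GL2 p) = (g : GL2 p)⁻¹ := rfl
    constructor <;>
    · show (((g⁻¹ : ↥(Bsub p)) : GL2 p) : Matrix (Fin 2) (Fin 2) ℤ_[p]) _ _ = 1
      rw [hco, Matrix.coe_units_inv, Matrix.inv_def]
      simp [Matrix.adjugate_fin_two, Matrix.det_fin_two, hg.1, hg.2, hg10]

/-- `T(ℤ_p)`: the diagonal torus, as a subgroup of `B(ℤ_p)`. -/
def Tsub : Subgroup ↥(Bsub p) where
  carrier := {g | ((g : GL2 p) : Matrix (Fin 2) (Fin 2) ℤ_[p]) 0 1 = 0}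
  one_mem' := by
    show ((1 : GL2 p) : Matrix (Fin 2) (Fin 2) ℤ_[p]) 0 1 = 0
    rw [Units.val_one]
    simp [Matrix.one_apply]
  mul_mem' := by
    intro a b ha hb
    simp only [Set.mem_setOf_eq] at ha hb ⊢
    show (((a * b : ↥(Bsub p)) : GL2 p) : Matrix (Fin 2) (Fin 2) ℤ_[p]) 0 1 = 0
    rw [show ((a * b : ↥(Bsub p)) : GL2 p) = (a : GL2 p) * (b : GL2 p) from rfl]
    rw [Units.val_mul, Matrix.mul_apply, Fin.sum_univ_two]
    simp [ha, hb]
  inv_mem' := by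
    intro g hg
    simp only [Set.mem_setOf_eq] at hg ⊢
    show (((g⁻¹ : ↥(Bsub p)) : GL2 p) : Matrix (Fin 2) (Fin 2) ℤ_[p]) 0 1 = 0
    rw [show ((g⁻¹ : ↥(Bsub p)) : GL2 p) = (g : GL2 p)⁻¹ from rfl,
      Matrix.coe_units_inv, Matrix.inv_def]
    simp [Matrix.adjugate_fin_two, hg]

variable (F : Type*) [Field F] [CharP F p]

/-- The reduction map `ℤ_p → 𝔽_p ⊆ F` ("bar"). -/
noncomputable def red : ℤ_[p] →+* F :=
  (ZMod.castHom dvd_rfl F).comp PadicInt.toZMod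

/-- `Sym¹F²`: the representation of `K = GL₂(ℤ_p)` on `F² = FX ⊕ FY` obtained by
reducing the matrix entries modulo `p` (`X`, `Y` being the standard basis vectors). -/
noncomputable def sym1Rep : Representation F (GL2 p) (Fin 2 → F) where
  toFun g := Matrix.toLin' ((g : Matrix (Fin 2) (Fin 2) ℤ_[p]).map (red p F))
  map_one' := by
    show Matrix.toLin' (((1 : GL2 p) :
        Matrix (Fin 2) (Fin 2) ℤ_[p]).map (red p F)) = 1
    rw [Units.val_one, Matrix.map_one _ (map_zero _) (map_one _), Matrix.toLin'_one]
    rfl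
  map_mul' := by
    intro g h
    show Matrix.toLin' (((g * h : GL2 p) :
        Matrix (Fin 2) (Fin 2) ℤ_[p]).map (red p F)) = _
    rw [Units.val_mul, Matrix.map_mul, Matrix.toLin'_mul]
    rfl

/-- The `(i,j)`-entry of an element of `T(ℤ_p)` (or `B(ℤ_p)`). -/
def tentry (t : ↥(Tsub p)) (i j : Fin 2) : ℤ_[p] :=
  (((t : ↥(Bsub p)) : GL2 p) : Matrix (Fin 2) (Fin 2) ℤ_[p]) i j

end Setup

/-- The `B(ℤ_p)`-representation `Sym¹F² ⊗_F W`. -/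
noncomputable def symTensor (p : ℕ) [Fact p.Prime] (F : Type*) [Field F] [CharP F p]
    {W : Type*} [AddCommGroup W] [Module F W] (ρ : Representation F ↥(Bsub p) W) :
    Representation F ↥(Bsub p) ((Fin 2 → F) ⊗[F] W) :=
  Representation.tprod ((sym1Rep p F).comp (Bsub p).subtype) ρ

/-- The kernel of the projection onto the `U(ℤ_p)`-coinvariants: the subspace spanned by
all elements `u·w − w` with `u ∈ U(ℤ_p)`, `w ∈ W`. -/
def coinvKer (p : ℕ) [Fact p.Prime] (F : Type*) [Field F] [CharP F p]
    {W : Type*} [AddCommGroup W] [Module F W] (ρ : Representation F ↥(Bsub p) W) :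
    Submodule F W :=
  Submodule.span F {w | ∃ u : ↥(Usub p), ∃ v : W, w = ρ (u : ↥(Bsub p)) v - v}

section Unipotent

variable (p : ℕ) [Fact p.Prime]

/-- The unipotent matrix `(1 x; 0 1)` as an element of `B(ℤ_p)`. -/
noncomputable def unip (x : ℤ_[p]) : ↥(Bsub p) :=
  ⟨⟨!![1, x; 0, 1], !![1, -x; 0, 1],
    by simp [Matrix.one_fin_two], by simp [Matrix.one_fin_two]⟩,
    by simp [Bsub]⟩

theorem unip_coe (x : ℤ_[p]) :
    ((unip p x : GL2 p) : Matrix (Fin 2) (Fin 2) ℤ_[p]) = !![1, x; 0, 1] := rfl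

theorem unip_mem (x : ℤ_[p]) : unip p x ∈ Usub p := by
  constructor <;> simp [unip_coe]

theorem eq_unip (u : ↥(Usub p)) :
    (u : ↥(Bsub p)) =
      unip p ((((u : ↥(Bsub p)) : GL2 p) : Matrix (Fin 2) (Fin 2) ℤ_[p]) 0 1) := by
  apply Subtype.ext
  apply Units.ext
  rw [unip_coe]
  have h10 : (((u : ↥(Bsub p)) : GL2 p) : Matrix (Fin 2) (Fin 2) ℤ_[p]) 1 0 = 0 := u.1.2
  ext i j
  fin_cases i <;> fin_cases j
  · exact u.2.1
  · rfl
  · exact h10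
  · exact u.2.2

theorem unip_zero : unip p 0 = 1 := by
  apply Subtype.ext
  apply Units.ext
  rw [unip_coe]
  exact Matrix.one_fin_two.symm

theorem unip_add (x y : ℤ_[p]) : unip p (x + y) = unip p x * unip p y := by
  apply Subtype.ext
  apply Units.ext
  change !![1, x + y; 0, 1] = !![1, x; 0, 1] * !![1, y; 0, 1]
  simp [add_comm]

theorem unip_natCast (n : ℕ) : unip p n = unip p 1 ^ n := by
  induction n with
  | zero => simp [unip_zero]
  | succ k ih => rw [Nat.cast_succ, unip_add, ih, pow_succ]

theorem continuous_unip : Continuous (unip p) := by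
  refine Continuous.subtype_mk (Units.continuous_iff.2 ⟨?_, ?_⟩) _
  · refine continuous_matrix fun i j => ?_
    fin_cases i <;> fin_cases j <;> simp <;> fun_prop
  · refine continuous_matrix fun i j => ?_
    fin_cases i <;> fin_cases j <;> simp <;> fun_prop

/-- The element `diag(1, -1)` of `T(ℤ_p)`. -/
noncomputable def diagOneNegOne : ↥(Tsub p) :=
  ⟨⟨⟨!![1, 0; 0, -1], !![1, 0; 0, -1],
    by simp [Matrix.one_fin_two], by simp [Matrix.one_fin_two]⟩,
    by simp [Bsub]⟩, by simp [Tsub]⟩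

theorem Tsub_mul_comm (s t : ↥(Tsub p)) :
    (s : ↥(Bsub p)) * (t : ↥(Bsub p)) = (t : ↥(Bsub p)) * (s : ↥(Bsub p)) := by
  apply Subtype.ext
  apply Units.ext
  have hs1 : (((s : ↥(Bsub p)) : GL2 p) : Matrix (Fin 2) (Fin 2) ℤ_[p]) 0 1 = 0 := s.2
  have ht1 : (((t : ↥(Bsub p)) : GL2 p) : Matrix (Fin 2) (Fin 2) ℤ_[p]) 0 1 = 0 := t.2
  have hs2 : (((s : ↥(Bsub p)) : GL2 p) : Matrix (Fin 2) (Fin 2) ℤ_[p]) 1 0 = 0 := s.1.2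
  have ht2 : (((t : ↥(Bsub p)) : GL2 p) : Matrix (Fin 2) (Fin 2) ℤ_[p]) 1 0 = 0 := t.1.2
  simp only [Subgroup.coe_mul, Units.val_mul]
  ext i j
  rw [Matrix.mul_apply, Matrix.mul_apply, Fin.sum_univ_two, Fin.sum_univ_two]
  fin_cases i <;> fin_cases j <;> simp [hs1, ht1, hs2, ht2, mul_comm]

instance Usub_normal : (Usub p).Normal where
  conj_mem u hu b := by
    have hb : ((b : GL2 p) : Matrix (Fin 2) (Fin 2) ℤ_[p]) 1 0 = 0 := b.2
    have hb' : (((b⁻¹ : ↥(Bsub p)) : GL2 p) : Matrix (Fin 2) (Fin 2) ℤ_[p]) 1 0 = 0 :=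
      (b⁻¹).2
    have hu' : ((u : GL2 p) : Matrix (Fin 2) (Fin 2) ℤ_[p]) 1 0 = 0 := u.2
    have h : ((b : GL2 p) : Matrix (Fin 2) (Fin 2) ℤ_[p]) *
        (((b⁻¹ : ↥(Bsub p)) : GL2 p) : Matrix (Fin 2) (Fin 2) ℤ_[p]) = 1 := by
      rw [← Units.val_mul, ← Subgroup.coe_mul, mul_inv_cancel]
      rfl
    have h00 := congrFun (congrFun h 0) 0
    have h11 := congrFun (congrFun h 1) 1
    rw [Matrix.mul_apply, Fin.sum_univ_two] at h00 h11
    rw [hb', mul_zero, add_zero, Matrix.one_apply_eq] at h00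
    rw [hb, zero_mul, zero_add, Matrix.one_apply_eq] at h11
    constructor
    · simp only [Subgroup.coe_mul, Units.val_mul, Matrix.mul_apply, Fin.sum_univ_two]
      simp only [hb', hu', hu.1, hu.2]
      simpa using h00
    · simp only [Subgroup.coe_mul, Units.val_mul, Matrix.mul_apply, Fin.sum_univ_two]
      simp only [hb, hu', hu.1, hu.2]
      simpa using h11

end Unipotent

section Coinvariants

variable (p : ℕ) [Fact p.Prime] (F : Type*) [Field F] [CharP F p]
  {W : Type*} [AddCommGroup W] [Module F W] (ρ : Representation F ↥(Bsub p) W)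

theorem coinvKer_stable (b : ↥(Bsub p)) {w : W} (hw : w ∈ coinvKer p F ρ) :
    ρ b w ∈ coinvKer p F ρ := by
  suffices coinvKer p F ρ ≤ (coinvKer p F ρ).comap (ρ b) from this hw
  refine Submodule.span_le.2 ?_
  rintro _ ⟨u, v, rfl⟩
  refine Submodule.subset_span
    ⟨⟨b * u * b⁻¹, (Usub_normal p).conj_mem _ u.2 b⟩, ρ b v, ?_⟩
  simp only [map_sub, ← Module.End.mul_apply, ← map_mul]
  simp

/-- If every `u ∈ U(ℤ_p)` acts as a power of `(1 1; 0 1)`, the kernel of the projection to the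
coinvariants is the range of `(1 1; 0 1) - 1`. -/
theorem coinvKer_eq_range (h : ∀ u : ↥(Usub p), ∃ n : ℕ, ρ u = ρ (unip p 1) ^ n) :
    coinvKer p F ρ = LinearMap.range (ρ (unip p 1) - 1) := by
  apply le_antisymm
  · refine Submodule.span_le.2 ?_
    rintro _ ⟨u, v, rfl⟩
    obtain ⟨n, hn⟩ := h u
    obtain ⟨g, hg⟩ := sub_one_dvd_pow_sub_one (ρ (unip p 1)) n
    refine ⟨g v, ?_⟩
    rw [← Module.End.mul_apply, ← hg, hn]
    rfl
  · rintro _ ⟨v, rfl⟩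
    exact Submodule.subset_span ⟨⟨unip p 1, unip_mem p 1⟩, v, rfl⟩

omit [CharP F p] in
theorem exists_unip_trivial [FiniteDimensional F W]
    (hsmooth : ∀ w : W, IsOpen {b : ↥(Bsub p) | ρ b w = w}) :
    ∃ k : ℕ, ∀ x : ℤ_[p], ρ (unip p ((p : ℤ_[p]) ^ (k + 1) * x)) = 1 := by
  let e := Module.finBasis F W
  have hopen : IsOpen (⋂ i, {x : ℤ_[p] | ρ (unip p x) (e i) = e i}) :=
    isOpen_iInter_of_finite fun i => (hsmooth (e i)).preimage (continuous_unip p)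
  obtain ⟨ε, hε, hball⟩ := Metric.isOpen_iff.1 hopen 0 (by simp [unip_zero])
  obtain ⟨k, hk⟩ := PadicInt.exists_pow_neg_lt p hε
  refine ⟨k, fun x => e.ext fun i => ?_⟩
  refine Set.mem_iInter.1 (hball ?_) i
  rw [mem_ball_zero_iff, pow_succ, mul_assoc, norm_mul, PadicInt.norm_p_pow]
  refine lt_of_le_of_lt ?_ hk
  exact mul_le_of_le_one_right (by positivity) (PadicInt.norm_le_one _)

theorem red_natCast_p : red p F (p : ℤ_[p]) = 0 := by
  rw [map_natCast, CharP.cast_eq_zero]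

theorem exists_natCast_act [FiniteDimensional F W]
    (hsmooth : ∀ w : W, IsOpen {b : ↥(Bsub p) | ρ b w = w}) (x : ℤ_[p]) :
    ∃ n : ℕ, ρ (unip p x) = ρ (unip p 1) ^ n ∧ red p F x = n := by
  obtain ⟨k, hk⟩ := exists_unip_trivial p F ρ hsmooth
  obtain ⟨y, hy⟩ := Ideal.mem_span_singleton.1 (PadicInt.appr_spec (k + 1) x)
  have hx : x = (x.appr (k + 1) : ℕ) + (p : ℤ_[p]) ^ (k + 1) * y := by
    rw [← hy]; ring
  refine ⟨x.appr (k + 1), ?_, ?_⟩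
  · conv_lhs => rw [hx]
    rw [unip_add, map_mul, hk, mul_one, unip_natCast, map_pow]
  · conv_lhs => rw [hx]
    rw [map_add, map_mul, map_pow, red_natCast_p]
    simp

theorem isNilpotent_unip_sub_one [FiniteDimensional F W]
    (hsmooth : ∀ w : W, IsOpen {b : ↥(Bsub p) | ρ b w = w}) :
    IsNilpotent (ρ (unip p 1) - 1) := by
  obtain ⟨k, hk⟩ := exists_unip_trivial p F ρ hsmooth
  refine ⟨p ^ (k + 1), ?_⟩
  cases subsingleton_or_nontrivial W
  · exact Subsingleton.elim _ _
  have : CharP (Module.End F W) p := charP_of_injective_algebraMap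
    (FaithfulSMul.algebraMap_injective F (Module.End F W)) p
  rw [sub_pow_char_pow_of_commute p (k + 1) (Commute.one_right _), ← map_pow, ← unip_natCast,
    one_pow]
  have := hk 1
  rw [mul_one] at this
  push_cast
  rw [this, sub_self]

theorem sym1Rep_apply (g : GL2 p) (f : Fin 2 → F) :
    sym1Rep p F g f =
      ((g : Matrix (Fin 2) (Fin 2) ℤ_[p]).map (red p F)).mulVec f := rfl

theorem symTensor_tmul (b : ↥(Bsub p)) (f : Fin 2 → F) (w : W) :
    symTensor p F ρ b (f ⊗ₜ w) = sym1Rep p F (b : GL2 p) f ⊗ₜ ρ b w := rfl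

theorem sym1Rep_unip (x : ℤ_[p]) (f : Fin 2 → F) :
    sym1Rep p F (unip p x : GL2 p) f = ![f 0 + red p F x * f 1, f 1] := by
  rw [sym1Rep_apply, unip_coe]
  ext i
  fin_cases i <;> simp [Matrix.mulVec, dotProduct, Fin.sum_univ_two]

theorem symTensor_unip_eq_pow [FiniteDimensional F W]
    (hsmooth : ∀ w : W, IsOpen {b : ↥(Bsub p) | ρ b w = w}) (u : ↥(Usub p)) :
    ∃ n : ℕ, symTensor p F ρ u = symTensor p F ρ (unip p 1) ^ n := by
  rw [eq_unip p u]
  obtain ⟨n, hn, hr⟩ := exists_natCast_act p F ρ hsmooth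
    ((((u : ↥(Bsub p)) : GL2 p) : Matrix (Fin 2) (Fin 2) ℤ_[p]) 0 1)
  refine ⟨n, ?_⟩
  rw [← map_pow, ← unip_natCast]
  refine TensorProduct.ext' fun f w => ?_
  rw [symTensor_tmul, symTensor_tmul, sym1Rep_unip, sym1Rep_unip, hr, hn, map_natCast,
    unip_natCast, map_pow]

theorem coinvKer_eq [FiniteDimensional F W]
    (hsmooth : ∀ w : W, IsOpen {b : ↥(Bsub p) | ρ b w = w}) :
    coinvKer p F ρ = LinearMap.range (ρ (unip p 1) - 1) := by
  refine coinvKer_eq_range p F ρ fun u => ?_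
  rw [eq_unip p u]
  obtain ⟨n, hn, -⟩ := exists_natCast_act p F ρ hsmooth
    ((((u : ↥(Bsub p)) : GL2 p) : Matrix (Fin 2) (Fin 2) ℤ_[p]) 0 1)
  exact ⟨n, hn⟩

theorem coinvKer_symTensor_eq [FiniteDimensional F W]
    (hsmooth : ∀ w : W, IsOpen {b : ↥(Bsub p) | ρ b w = w}) :
    coinvKer p F (symTensor p F ρ) = LinearMap.range (symTensor p F ρ (unip p 1) - 1) :=
  coinvKer_eq_range p F _ (symTensor_unip_eq_pow p F ρ hsmooth)

/-- The map `X ⊗ x + Y ⊗ y ↦ N x - y`. -/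
noncomputable def symMap (N : Module.End F W) : (Fin 2 → F) ⊗[F] W →ₗ[F] W :=
  TensorProduct.lift
    ((LinearMap.proj 0 : (Fin 2 → F) →ₗ[F] F).smulRight N -
      (LinearMap.proj 1 : (Fin 2 → F) →ₗ[F] F).smulRight (1 : Module.End F W))

theorem symMap_tmul (N : Module.End F W) (f : Fin 2 → F) (w : W) :
    symMap F N (f ⊗ₜ w) = f 0 • N w - f 1 • w := by
  simp [symMap]

theorem symMap_symTensor_sub (v : (Fin 2 → F) ⊗[F] W) :
    symMap F (ρ (unip p 1) - 1) ((symTensor p F ρ (unip p 1) - 1) v) ∈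
      LinearMap.range ((ρ (unip p 1) - 1) ^ 2) := by
  induction v using TensorProduct.induction_on with
  | zero => simp
  | add x y hx hy => rw [map_add, map_add]; exact add_mem hx hy
  | tmul f w =>
    refine ⟨(f 0 + f 1) • w, ?_⟩
    rw [LinearMap.sub_apply, Module.End.one_apply, map_sub, symTensor_tmul, sym1Rep_unip,
      symMap_tmul, symMap_tmul]
    simp only [pow_two, Module.End.mul_apply, LinearMap.sub_apply, Module.End.one_apply, map_smul,
      map_sub, map_one]
    simp
    module

theorem tmul_single_zero_mem [FiniteDimensional F W]
    (hsmooth : ∀ w : W, IsOpen {b : ↥(Bsub p) | ρ b w = w}) (w : W) (hw : w ∈ coinvKer p F ρ) :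
    (![1, 0] : Fin 2 → F) ⊗ₜ[F] w ∈ coinvKer p F (symTensor p F ρ) := by
  rw [coinvKer_eq p F ρ hsmooth] at hw
  obtain ⟨c, rfl⟩ := hw
  rw [coinvKer_symTensor_eq p F ρ hsmooth]
  refine ⟨![1, 0] ⊗ₜ c, ?_⟩
  rw [LinearMap.sub_apply, symTensor_tmul, sym1Rep_unip]
  simp [TensorProduct.tmul_sub]

theorem tmul_single_one_add_mem (c : W) :
    (![0, 1] : Fin 2 → F) ⊗ₜ[F] ((ρ (unip p 1) - 1) c) +
      (![1, 0] : Fin 2 → F) ⊗ₜ[F] (ρ (unip p 1) c) ∈ coinvKer p F (symTensor p F ρ) := by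
  refine Submodule.subset_span ⟨⟨unip p 1, unip_mem p 1⟩, ![0, 1] ⊗ₜ c, ?_⟩
  rw [symTensor_tmul, sym1Rep_unip]
  have : (![(![0, 1] : Fin 2 → F) 0 + red p F 1 * (![0, 1] : Fin 2 → F) 1,
      (![0, 1] : Fin 2 → F) 1] : Fin 2 → F) = ![0, 1] + ![1, 0] := by
    ext i; fin_cases i <;> simp
  rw [this, TensorProduct.add_tmul, LinearMap.sub_apply, TensorProduct.tmul_sub,
    Module.End.one_apply]
  abel

theorem tmul_eq_add (f : Fin 2 → F) (w : W) :
    f ⊗ₜ[F] w = (![1, 0] : Fin 2 → F) ⊗ₜ[F] (f 0 • w) + (![0, 1] : Fin 2 → F) ⊗ₜ[F] (f 1 • w) := by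
  rw [← TensorProduct.smul_tmul, ← TensorProduct.smul_tmul, ← TensorProduct.add_tmul]
  congr 1
  ext i; fin_cases i <;> simp

theorem symTensor_torus_zero (t : ↥(Tsub p)) (w : W) :
    symTensor p F ρ t ((![1, 0] : Fin 2 → F) ⊗ₜ[F] w) =
      red p F (tentry p t 0 0) • ((![1, 0] : Fin 2 → F) ⊗ₜ[F] ρ t w) := by
  have h : tentry p t 1 0 = 0 := t.1.2
  rw [symTensor_tmul, sym1Rep_apply, TensorProduct.smul_tmul']
  congr 1
  unfold tentry at *
  ext i; fin_cases i <;> simp [Matrix.mulVec, dotProduct, Fin.sum_univ_two, h]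

theorem symTensor_torus_one (t : ↥(Tsub p)) (w : W) :
    symTensor p F ρ t ((![0, 1] : Fin 2 → F) ⊗ₜ[F] w) =
      red p F (tentry p t 1 1) • ((![0, 1] : Fin 2 → F) ⊗ₜ[F] ρ t w) := by
  have h : tentry p t 0 1 = 0 := t.2
  rw [symTensor_tmul, sym1Rep_apply, TensorProduct.smul_tmul']
  congr 1
  unfold tentry at *
  ext i; fin_cases i <;> simp [Matrix.mulVec, dotProduct, Fin.sum_univ_two, h]

end Coinvariants

/-- A nilpotent endomorphism `N` with one-dimensional cokernel on a space of dimension at least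
two does not map a generator of the cokernel into the range of `N ^ 2`. -/
theorem apply_notMem_range_sq {F W : Type*} [Field F] [AddCommGroup W] [Module F W]
    (hdim : 2 ≤ Module.finrank F W) {N : Module.End F W} (hN : IsNilpotent N)
    {w₀ : W} (hw : ∀ w, ∃ (a : F) (c : W), w = a • w₀ + N c) :
    N w₀ ∉ LinearMap.range (N ^ 2) := by
  rintro ⟨c₀, hc₀⟩
  have hstep : ∀ w, ∃ c, N w = N (N c) := by
    intro w
    obtain ⟨a, c, rfl⟩ := hw w
    refine ⟨a • c₀ + c, ?_⟩
    rw [pow_two, Module.End.mul_apply] at hc₀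
    simp [hc₀]
  have hiter : ∀ n w, ∃ c, N w = (N ^ n) (N c) := by
    intro n
    induction n with
    | zero => exact fun w => ⟨w, rfl⟩
    | succ k ih =>
      intro w
      obtain ⟨c, hc⟩ := ih w
      obtain ⟨c', hc'⟩ := hstep c
      exact ⟨c', by rw [hc, hc', pow_succ, Module.End.mul_apply]⟩
  obtain ⟨n, hn⟩ := hN
  have h0 : ∀ w, N w = 0 := fun w => by
    obtain ⟨c, hc⟩ := hiter n w
    rw [hc, hn, LinearMap.zero_apply]
  have : Module.finrank F W ≤ 1 := finrank_le_one w₀ fun w => by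
    obtain ⟨a, c, hc⟩ := hw w
    exact ⟨a, by rw [hc, h0, add_zero]⟩
  omega

set_option maxHeartbeats 1000000 in
theorem statement5 (p : ℕ) [Fact p.Prime] (hp : 5 ≤ p)
    (F : Type*) [Field F] [CharP F p]
    {W : Type*} [AddCommGroup W] [Module F W]
    (ρ : Representation F ↥(Bsub p) W)
    (hsmooth : ∀ w : W, IsOpen {b : ↥(Bsub p) | ρ b w = w})
    [FiniteDimensional F W] (hdim : 2 ≤ Module.finrank F W)
    (hcoinv1 : Module.finrank F (W ⧸ coinvKer p F ρ) = 1)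
    (χ : ↥(Tsub p) →* Fˣ)
    (hχ : ∀ (t : ↥(Tsub p)) (w : W),
      ρ (t : ↥(Bsub p)) w - (χ t : F) • w ∈ coinvKer p F ρ) :
    Module.finrank F
      (((Fin 2 → F) ⊗[F] W) ⧸ coinvKer p F (symTensor p F ρ)) = 2 ∧
    ∃ v₁ v₂ : (Fin 2 → F) ⊗[F] W,
      Submodule.Quotient.mk (p := coinvKer p F (symTensor p F ρ)) v₁ ≠ 0 ∧
      Submodule.Quotient.mk (p := coinvKer p F (symTensor p F ρ)) v₂ ≠ 0 ∧
      Submodule.span F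
        {Submodule.Quotient.mk (p := coinvKer p F (symTensor p F ρ)) v₁,
         Submodule.Quotient.mk (p := coinvKer p F (symTensor p F ρ)) v₂} = ⊤ ∧
      (∀ t : ↥(Tsub p),
        symTensor p F ρ (t : ↥(Bsub p)) v₁ -
            ((χ t : F) * red p F (tentry p t 0 0)) • v₁ ∈
          coinvKer p F (symTensor p F ρ)) ∧
      (∀ t : ↥(Tsub p),
        symTensor p F ρ (t : ↥(Bsub p)) v₂ -
            ((χ t : F) * red p F (tentry p t 1 1)) • v₂ ∈
          coinvKer p F (symTensor p F ρ)) := by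
  have hK := coinvKer_eq p F ρ hsmooth
  have hKV := coinvKer_symTensor_eq p F ρ hsmooth
  have hX := tmul_single_zero_mem p F ρ hsmooth
  have hY := tmul_single_one_add_mem p F ρ
  have hφ := symMap_symTensor_sub p F ρ
  have hnil := isNilpotent_unip_sub_one p F ρ hsmooth
  obtain ⟨q₀, hq₀, hq⟩ := finrank_eq_one_iff'.1 hcoinv1
  obtain ⟨w₀, rfl⟩ := Submodule.Quotient.mk_surjective _ q₀
  have hw₀ : w₀ ∉ LinearMap.range (ρ (unip p 1) - 1) := by
    rw [← hK]
    exact fun h => hq₀ ((Submodule.Quotient.mk_eq_zero _).2 h)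
  have hw : ∀ w, ∃ (a : F) (c : W), w = a • w₀ + (ρ (unip p 1) - 1) c := by
    intro w
    obtain ⟨a, ha⟩ := hq (Submodule.Quotient.mk w)
    rw [← Submodule.Quotient.mk_smul, eq_comm, Submodule.Quotient.eq, hK] at ha
    obtain ⟨c, hc⟩ := ha
    exact ⟨a, c, by rw [hc]; abel⟩
  have hNw₀ := apply_notMem_range_sq hdim hnil hw
  set N := ρ (unip p 1) - 1 with hNdef
  set σ := symTensor p F ρ with hσ
  set K := coinvKer p F σ with hKdef
  let x : (Fin 2 → F) ⊗[F] W := ![1, 0] ⊗ₜ w₀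
  let y : (Fin 2 → F) ⊗[F] W := ![0, 1] ⊗ₜ w₀
  have hxw : ∀ w, ∃ a : F, (![1, 0] : Fin 2 → F) ⊗ₜ[F] w - a • x ∈ K := by
    intro w
    obtain ⟨a, c, rfl⟩ := hw w
    refine ⟨a, ?_⟩
    have := hX (N c) (hK ▸ ⟨c, rfl⟩)
    simpa [x, TensorProduct.tmul_add] using this
  have hyN : ∀ c, ∃ a : F, (![0, 1] : Fin 2 → F) ⊗ₜ[F] (N c) - a • x ∈ K := by
    intro c
    obtain ⟨a, ha⟩ := hxw (ρ (unip p 1) c)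
    refine ⟨-a, ?_⟩
    convert sub_mem (hY c) ha using 1
    module
  have hindep : ∀ a b : F, a • x + b • y ∈ K → a = 0 ∧ b = 0 := by
    intro a b hab
    rw [hKV] at hab
    obtain ⟨v, hv⟩ := hab
    have h := hφ v
    rw [hv, map_add, map_smul, map_smul, symMap_tmul, symMap_tmul] at h
    simp only [Matrix.cons_val_zero, Matrix.cons_val_one, one_smul, zero_smul, sub_zero,
      zero_sub] at h
    have hb : b = 0 := by
      by_contra hb
      obtain ⟨c, hc⟩ := h
      rw [pow_two, Module.End.mul_apply] at hc
      refine hw₀ ⟨b⁻¹ • (a • w₀ - N c), ?_⟩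
      rw [map_smul, map_sub, map_smul, hc, smul_neg]
      simp [hb]
    subst hb
    refine ⟨?_, rfl⟩
    by_contra ha
    rw [zero_smul, add_zero] at h
    exact hNw₀ ((Submodule.smul_mem_iff _ ha).1 h)
  have hspan : ∀ v, ∃ a b : F, v - (a • x + b • y) ∈ K := by
    intro v
    induction v using TensorProduct.induction_on with
    | zero => exact ⟨0, 0, by simp⟩
    | add v v' hv hv' =>
      obtain ⟨a, b, h⟩ := hv
      obtain ⟨a', b', h'⟩ := hv'
      refine ⟨a + a', b + b', ?_⟩
      convert add_mem h h' using 1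
      module
    | tmul f w =>
      rw [tmul_eq_add]
      obtain ⟨a, ha⟩ := hxw (f 0 • w)
      obtain ⟨b, c, hc⟩ := hw (f 1 • w)
      obtain ⟨d, hd⟩ := hyN c
      refine ⟨a + d, b, ?_⟩
      rw [hc, TensorProduct.tmul_add, TensorProduct.tmul_smul b]
      convert add_mem ha hd using 1
      simp only [y]
      module
  have htx : ∀ t : ↥(Tsub p),
      σ t x - ((χ t : F) * red p F (tentry p t 0 0)) • x ∈ K := by
    intro t
    convert K.smul_mem (red p F (tentry p t 0 0)) (hX _ (hχ t w₀)) using 1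
    rw [hσ, symTensor_torus_zero, TensorProduct.tmul_sub, TensorProduct.tmul_smul]
    simp only [x]
    module
  have hty : ∀ t : ↥(Tsub p), ∃ c : F,
      σ t y - (((χ t : F) * red p F (tentry p t 1 1)) • y + c • x) ∈ K := by
    intro t
    obtain ⟨b, hb⟩ := hK ▸ hχ t w₀
    obtain ⟨a, ha⟩ := hyN b
    refine ⟨red p F (tentry p t 1 1) * a, ?_⟩
    convert K.smul_mem (red p F (tentry p t 1 1)) ha using 1
    rw [hσ, symTensor_torus_one, hb, TensorProduct.tmul_sub, TensorProduct.tmul_smul]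
    simp only [y]
    module
  choose c hc using hty
  have hcomm : ∀ s t : ↥(Tsub p),
      c t * ((χ s : F) * (red p F (tentry p s 1 1) - red p F (tentry p s 0 0))) =
      c s * ((χ t : F) * (red p F (tentry p t 1 1) - red p F (tentry p t 0 0))) := by
    have key : ∀ s t : ↥(Tsub p),
        σ (s * t : ↥(Bsub p)) y -
          (((χ t : F) * red p F (tentry p t 1 1)) •
            (((χ s : F) * red p F (tentry p s 1 1)) • y + c s • x) +
          c t • ((χ s : F) * red p F (tentry p s 0 0)) • x) ∈ K := by
      intro s t
      have h1 := coinvKer_stable p F σ s (hc t)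
      have h2 := K.smul_mem ((χ t : F) * red p F (tentry p t 1 1)) (hc s)
      have h3 := K.smul_mem (c t) (htx s)
      convert add_mem h1 (add_mem h2 h3) using 1
      rw [map_mul, Module.End.mul_apply, map_sub, map_add, map_smul, map_smul]
      module
    intro s t
    have h1 := key s t
    rw [Tsub_mul_comm] at h1
    have h2 := (hindep (c t * ((χ s : F) * (red p F (tentry p s 1 1) - red p F (tentry p s 0 0))) -
      c s * ((χ t : F) * (red p F (tentry p t 1 1) - red p F (tentry p t 0 0)))) 0 (by
        convert sub_mem h1 (key t s) using 1
        module)).1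
    exact sub_eq_zero.1 h2
  obtain ⟨γ, hγ⟩ : ∃ γ : F, ∀ t : ↥(Tsub p),
      c t = γ * ((χ t : F) * (red p F (tentry p t 1 1) - red p F (tentry p t 0 0))) := by
    have h0 : red p F (tentry p (diagOneNegOne p) 1 1) -
        red p F (tentry p (diagOneNegOne p) 0 0) ≠ 0 := by
      have h1 : tentry p (diagOneNegOne p) 1 1 = -1 := rfl
      have h2 : tentry p (diagOneNegOne p) 0 0 = 1 := rfl
      rw [h1, h2, map_neg, map_one]
      have : ((2 : ℕ) : F) ≠ 0 := by
        rw [Ne, CharP.cast_eq_zero_iff F p]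
        exact fun h => absurd (Nat.le_of_dvd two_pos h) (by omega)
      intro h
      apply this
      push_cast
      linear_combination -h
    have h1 := mul_ne_zero (χ (diagOneNegOne p)).ne_zero h0
    refine ⟨c (diagOneNegOne p) / ((χ (diagOneNegOne p) : F) *
      (red p F (tentry p (diagOneNegOne p) 1 1) - red p F (tentry p (diagOneNegOne p) 0 0))),
      fun t => ?_⟩
    rw [div_mul_eq_mul_div, eq_div_iff h1]
    exact hcomm (diagOneNegOne p) t
  have hli : LinearIndependent F ![Submodule.Quotient.mk (p := K) x,
      Submodule.Quotient.mk (p := K) (y + γ • x)] := by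
    rw [LinearIndependent.pair_iff]
    intro a b hab
    rw [← Submodule.Quotient.mk_smul, ← Submodule.Quotient.mk_smul, ← Submodule.Quotient.mk_add,
      Submodule.Quotient.mk_eq_zero] at hab
    obtain ⟨h1, h2⟩ := hindep (a + b * γ) b (by convert hab using 1; module)
    subst h2
    exact ⟨by simpa using h1, rfl⟩
  have htop : Submodule.span F {Submodule.Quotient.mk (p := K) x,
      Submodule.Quotient.mk (p := K) (y + γ • x)} = ⊤ := by
    refine eq_top_iff.2 fun q _ => ?_
    obtain ⟨v, rfl⟩ := Submodule.Quotient.mk_surjective _ q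
    obtain ⟨a, b, h⟩ := hspan v
    rw [Submodule.mem_span_pair]
    refine ⟨a - b * γ, b, ?_⟩
    rw [← Submodule.Quotient.mk_smul, ← Submodule.Quotient.mk_smul, ← Submodule.Quotient.mk_add,
      eq_comm, Submodule.Quotient.eq]
    convert h using 1
    module
  refine ⟨?_, x, y + γ • x, hli.ne_zero 0, hli.ne_zero 1, htop, htx, fun t => ?_⟩
  · have h := finrank_span_eq_card hli
    rw [Matrix.range_cons_cons_empty, htop, finrank_top] at h
    simpa using h
  · convert add_mem (hc t) (K.smul_mem γ (htx t)) using 1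
    rw [map_add, map_smul, hγ t]
    module
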